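/- arXiv:2603.04258 — 6 statements merged into one kernel-verified Lean document; each statement's English description precedes it below -/
import Mathlib

section
/- Let $n \ge 1$, let $H$ be a real symmetric $n \times n$ matrix, let $v \in \mathbb{R}^n$, and set $M = H - \mathrm{tr}(H)\, I$, where $I$ is the identity matrix. Then $\|M v\|^2 \le (n-1)\, \|H\|_F^2\, \|v\|^2$, where $\|H\|_F^2 = \sum_{j,k} H_{jk}^2$ is the squared Frobenius norm and $\|\cdot\|$ is the Euclidean norm on $\mathbb{R}^n$. -/
open Matrix BigOperators

/-- A real symmetric matrix is orthogonally diagonalizable. -/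
lemma Matrix.IsSymm.exists_orthogonal_diagonalization {ι : Type*} [Fintype ι] [DecidableEq ι]
    {H : Matrix ι ι ℝ} (hH : H.IsSymm) :
    ∃ (U : Matrix ι ι ℝ) (d : ι → ℝ), Uᵀ * U = 1 ∧ U * Uᵀ = 1 ∧ H = U * diagonal d * Uᵀ := by
  have hA : H.IsHermitian := by
    rw [Matrix.IsHermitian, conjTranspose_eq_transpose_of_trivial]
    exact hH
  refine ⟨hA.eigenvectorUnitary, hA.eigenvalues, ?_, ?_, ?_⟩
  · simpa [star_eq_conjTranspose] using Unitary.coe_star_mul_self hA.eigenvectorUnitary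
  · simpa [star_eq_conjTranspose] using Unitary.coe_mul_star_self hA.eigenvectorUnitary
  · simpa [Unitary.conjStarAlgAut_apply, star_eq_conjTranspose, Function.comp_def]
      using hA.spectral_theorem

/-- A matrix with orthonormal columns preserves the sum of squares of a vector. -/
lemma Matrix.sum_mulVec_sq_of_transpose_mul_self {ι κ : Type*} [Fintype ι] [Fintype κ]
    [DecidableEq κ] {U : Matrix ι κ ℝ} (hU : Uᵀ * U = 1) (x : κ → ℝ) :
    ∑ i, (U *ᵥ x) i ^ 2 = ∑ i, x i ^ 2 := by
  have h : (U *ᵥ x) ⬝ᵥ (U *ᵥ x) = x ⬝ᵥ x := by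
    rw [dotProduct_mulVec, ← mulVec_transpose, mulVec_mulVec, hU, one_mulVec]
  simpa [dotProduct, sq] using h

/-- The sum of the squares of the entries of `A` is the trace of `A * Aᵀ`. -/
lemma Matrix.sum_sq_eq_trace_mul_transpose {ι κ : Type*} [Fintype ι] [Fintype κ]
    (A : Matrix ι κ ℝ) : ∑ j, ∑ k, A j k ^ 2 = (A * Aᵀ).trace := by
  simp [trace, mul_apply, sq]

/-- Cauchy–Schwarz for the sum of all terms of a family but one. -/
lemma sq_sub_sum_le {ι : Type*} [Fintype ι] [DecidableEq ι] (d : ι → ℝ) (i : ι) :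
    (d i - ∑ j, d j) ^ 2 ≤ ((Fintype.card ι : ℝ) - 1) * ∑ j, d j ^ 2 := by
  have hcard : ((Finset.univ.erase i).card : ℝ) = (Fintype.card ι : ℝ) - 1 := by
    rw [Finset.cast_card_erase_of_mem (Finset.mem_univ i), Finset.card_univ]
  have hsum := Finset.add_sum_erase Finset.univ d (Finset.mem_univ i)
  calc (d i - ∑ j, d j) ^ 2 = (∑ j ∈ Finset.univ.erase i, d j) ^ 2 := by rw [← hsum]; ring
    _ ≤ (Finset.univ.erase i).card * ∑ j ∈ Finset.univ.erase i, d j ^ 2 :=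
      sq_sum_le_card_mul_sum_sq
    _ ≤ (Finset.univ.erase i).card * ∑ j, d j ^ 2 := by
      gcongr
      exact Finset.erase_subset _ _
    _ = _ := by rw [hcard]

/-- The algebraic lemma (eq alg): for a real symmetric `n × n` matrix `H`, a vector `v`,
and `M = H - tr(H) I`, one has `‖M v‖² ≤ (n-1) ‖H‖_F² ‖v‖²`, where the squared
Euclidean norms are written out as sums of squares. -/
theorem stmt_0 (n : ℕ) (hn : 1 ≤ n) (H : Matrix (Fin n) (Fin n) ℝ) (hH : H.IsSymm)
    (v : Fin n → ℝ) (M : Matrix (Fin n) (Fin n) ℝ)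
    (hM : M = H - H.trace • (1 : Matrix (Fin n) (Fin n) ℝ)) :
    ∑ i, (M.mulVec v i) ^ 2 ≤
      ((n : ℝ) - 1) * (∑ j, ∑ k, (H j k) ^ 2) * (∑ i, (v i) ^ 2) := by
  obtain ⟨U, d, hU, hU', hHd⟩ := hH.exists_orthogonal_diagonalization
  have htr : H.trace = ∑ j, d j := by
    rw [hHd, trace_mul_comm, ← Matrix.mul_assoc, hU, Matrix.one_mul, trace_diagonal]
  have hfrob : ∑ j, ∑ k, H j k ^ 2 = ∑ j, d j ^ 2 := by
    have hsq : H * Hᵀ = U * (diagonal d * diagonal d * Uᵀ) := by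
      rw [hH.eq, hHd]
      calc U * diagonal d * Uᵀ * (U * diagonal d * Uᵀ)
          = U * diagonal d * (Uᵀ * U) * (diagonal d * Uᵀ) := by simp only [Matrix.mul_assoc]
        _ = _ := by rw [hU, Matrix.mul_one]; simp only [Matrix.mul_assoc]
    rw [sum_sq_eq_trace_mul_transpose, hsq, trace_mul_comm, Matrix.mul_assoc, hU, Matrix.mul_one,
      diagonal_mul_diagonal, trace_diagonal]
    simp only [sq]
  have hMv : M *ᵥ v = U *ᵥ fun i => (d i - ∑ j, d j) * (Uᵀ *ᵥ v) i := by
    have hdiag : (fun i => (d i - ∑ j, d j) * (Uᵀ *ᵥ v) i)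
        = diagonal d *ᵥ (Uᵀ *ᵥ v) - (∑ j, d j) • (Uᵀ *ᵥ v) := by
      ext i
      simp only [Pi.sub_apply, Pi.smul_apply, smul_eq_mul, mulVec_diagonal, sub_mul]
    rw [hdiag, mulVec_sub, mulVec_smul, mulVec_mulVec, mulVec_mulVec, mulVec_mulVec, hU',
      ← hHd, hM, htr, sub_mulVec, smul_mulVec]
  have hw : ∑ i, (Uᵀ *ᵥ v) i ^ 2 = ∑ i, v i ^ 2 :=
    sum_mulVec_sq_of_transpose_mul_self (by rwa [transpose_transpose]) v
  rw [hMv, sum_mulVec_sq_of_transpose_mul_self hU, hfrob, ← hw, Finset.mul_sum]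
  refine Finset.sum_le_sum fun i _ => ?_
  rw [mul_pow]
  gcongr
  simpa using sq_sub_sum_le d i
end

section
/- Let $a, b > 0$, $p > 1$, and let $\phi : [0,\infty) \to [0,\infty)$ be continuous and nonnegative. Suppose $u : [0,\infty) \to \mathbb{R}$ is differentiable with $u'(t) = b\, e^{-4u(t)} \phi(t) - a$ for all $t \ge 0$. Then for all $0 \le t_0 \le t$, $e^{4p\, u(t)} \le e^{4p\, u(t_0)} + 4b \left(\frac{(p-1)b}{pa}\right)^{p-1} \int_{t_0}^{t} \phi(s)^p\, ds$. (For $p = 2$ the constant $4b\big(\frac{(p-1)b}{pa}\big)^{p-1}$ equals $\frac{2b^2}{a}$.) -/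
/-- Young's inequality with optimal parameter: the maximum over `x > 0` of
`p x ^ p (b y / x - a)` is `b ((p - 1) b / (p a)) ^ (p - 1) y ^ p`. -/
theorem mul_rpow_mul_sub_le_rpow {a b p x y : ℝ} (ha : 0 < a) (hb : 0 < b) (hp : 1 < p)
    (hx : 0 < x) (hy : 0 ≤ y) :
    p * (x ^ p * (b * x⁻¹ * y - a)) ≤ b * ((p - 1) * b / (p * a)) ^ (p - 1) * y ^ p := by
  have hp0 : 0 < p := by linarith
  have hp1 : 0 < p - 1 := by linarith
  set c := (p - 1) * b / (p * a) with hc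
  have hc0 : 0 < c := by positivity
  have bernoulli : 1 + p * (c * y / x - 1) ≤ (c * y / x) ^ p := by
    have hs : -1 ≤ c * y / x - 1 := by
      have : 0 ≤ c * y / x := by positivity
      linarith
    simpa using one_add_mul_self_le_rpow_one_add hs hp.le
  have hpow : (c * y / x) ^ p * x ^ p = c * (c ^ (p - 1) * y ^ p) := by
    rw [← Real.mul_rpow (by positivity) hx.le, div_mul_cancel₀ _ hx.ne',
      Real.mul_rpow hc0.le hy, Real.rpow_sub_one hc0.ne']
    field_simp
  have hscaled := mul_le_mul_of_nonneg_right bernoulli (Real.rpow_nonneg hx.le p)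
  rw [hpow] at hscaled
  have hfactor : (1 + p * (c * y / x - 1)) * x ^ p
      = c / b * (p * (x ^ p * (b * x⁻¹ * y - a))) := by
    rw [hc]
    field_simp
    ring
  rw [hfactor] at hscaled
  refine le_of_mul_le_mul_left (hscaled.trans_eq ?_) (div_pos hc0 hb)
  field_simp

/-- Pointwise `e^{pu}` estimate: for a solution of `u' = b e^{-4u} φ - a` with `a,b > 0`,
`p > 1`, `φ ≥ 0` continuous, and all `0 ≤ t₀ ≤ t`,
`e^{4p u(t)} ≤ e^{4p u(t₀)} + 4b ((p-1)b/(pa))^{p-1} ∫_{t₀}^t φ(s)^p ds`. -/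
theorem stmt_4 (a b p : ℝ) (ha : 0 < a) (hb : 0 < b) (hp : 1 < p)
    (φ u : ℝ → ℝ) (hφc : ContinuousOn φ (Set.Ici 0)) (hφ0 : ∀ t ≥ (0:ℝ), 0 ≤ φ t)
    (hu : ∀ t ≥ (0:ℝ),
      HasDerivWithinAt u (b * Real.exp (-4 * u t) * φ t - a) (Set.Ici 0) t) :
    ∀ t₀ t : ℝ, 0 ≤ t₀ → t₀ ≤ t →
      Real.exp (4 * p * u t) ≤ Real.exp (4 * p * u t₀) +
        4 * b * ((p - 1) * b / (p * a)) ^ (p - 1) * ∫ s in t₀..t, φ s ^ p := by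
  intro t₀ t ht₀ ht
  have hsub : Set.Icc t₀ t ⊆ Set.Ici 0 := fun x hx => ht₀.trans hx.1
  have hp0 : 0 ≤ p := by linarith
  have hderiv : ∀ x ≥ (0:ℝ), HasDerivWithinAt (fun s => Real.exp (4 * p * u s))
      (Real.exp (4 * p * u x) * (4 * p * (b * Real.exp (-4 * u x) * φ x - a)))
      (Set.Ici 0) x := fun x hx => ((hu x hx).const_mul (4 * p)).exp
  have hint : MeasureTheory.IntegrableOn
      (fun s => 4 * b * ((p - 1) * b / (p * a)) ^ (p - 1) * φ s ^ p) (Set.Icc t₀ t) :=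
    (continuousOn_const.mul
      ((hφc.mono hsub).rpow_const fun _ _ => Or.inr hp0)).integrableOn_Icc
  have key := intervalIntegral.sub_le_integral_of_hasDeriv_right_of_le ht
    (fun x hx => ((hderiv x (hsub hx)).mono hsub).continuousWithinAt)
    (fun x hx => (hderiv x (ht₀.trans hx.1.le)).mono
      fun z hz => (ht₀.trans hx.1.le).trans (le_of_lt hz)) hint ?_
  · rw [intervalIntegral.integral_const_mul] at key
    linarith
  · intro x hx
    have hx0 : 0 ≤ x := ht₀.trans hx.1.le
    have young := mul_rpow_mul_sub_le_rpow ha hb hp (Real.exp_pos (4 * u x)) (hφ0 x hx0)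
    rw [← Real.exp_mul, ← Real.exp_neg, show 4 * u x * p = 4 * p * u x by ring,
      ← neg_mul] at young
    linarith
end

section
/- There exists a constant $C > 0$ such that for every $L \ge 1$, every smooth map $f : \mathbb{R}^4 \to \mathbb{R}^L$, and every smooth compactly supported function $\varphi : \mathbb{R}^4 \to \mathbb{R}$, $\int_{\mathbb{R}^4} |\nabla df|^2 |df|^2 \varphi^4 \le C \left( \int_{\mathrm{supp}\,\varphi} |df|^4 \right)^{1/2} \left( \int_{\mathbb{R}^4} |\nabla^2 df|^2 \varphi^4 + \int_{\mathbb{R}^4} |\nabla df|^2 \varphi^2 |\nabla \varphi|^2 \right)$. -/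
open MeasureTheory

open scoped NNReal ENNReal

section Multilinear

variable {ι E F : Type*} [Fintype ι] [NormedAddCommGroup E] [InnerProductSpace ℝ E]
  [NormedAddCommGroup F]

theorem ContinuousMultilinearMap.opNorm_le_sum_norm_orthonormalBasis [NormedSpace ℝ F]
    (b : OrthonormalBasis ι ℝ E) {n : ℕ} (M : ContinuousMultilinearMap ℝ (fun _ : Fin n ↦ E) F) :
    ‖M‖ ≤ ∑ r : Fin n → ι, ‖M fun k ↦ b (r k)‖ := by
  refine M.opNorm_le_bound (by positivity) fun m ↦ ?_
  have hm : m = fun k ↦ ∑ i, b.repr (m k) i • b i := by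
    ext1 k
    exact (b.sum_repr (m k)).symm
  conv_lhs => rw [hm, M.map_sum]
  refine (norm_sum_le _ _).trans ?_
  rw [Finset.sum_mul]
  refine Finset.sum_le_sum fun r _ ↦ ?_
  rw [M.map_smul_univ, norm_smul, mul_comm, norm_prod]
  gcongr with k
  exact (PiLp.norm_apply_le (b.repr (m k)) (r k)).trans_eq (b.repr.norm_map _)

variable [InnerProductSpace ℝ F] [FiniteDimensional ℝ E] [MeasurableSpace E] [BorelSpace E]

theorem eLpNorm_clm_comp_le_eLpNorm_fderiv_of_eq {V : Type*} [NormedAddCommGroup V]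
    [NormedSpace ℝ V] (μ : Measure E) [μ.IsAddHaarMeasure] {T : V →L[ℝ] F} (hT : ‖T‖ ≤ 1)
    {G : E → V} (hG : ContDiff ℝ 1 G) (h2G : HasCompactSupport G)
    {p p' : ℝ≥0} (hp : 1 ≤ p) (hn : 0 < Module.finrank ℝ E)
    (hp' : (p' : ℝ)⁻¹ = p⁻¹ - (Module.finrank ℝ E : ℝ)⁻¹) :
    eLpNorm (T ∘ G) p' μ ≤
      eLpNormLESNormFDerivOfEqInnerConst μ p * eLpNorm (fderiv ℝ G) p μ := by
  refine (eLpNorm_le_eLpNorm_fderiv_of_eq_inner μ (T.contDiff.comp hG)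
    (h2G.comp_left (map_zero _)) hp hn hp').trans ?_
  gcongr 1
  refine eLpNorm_mono fun x ↦ ?_
  rw [fderiv_comp x T.differentiableAt (hG.differentiable one_ne_zero x), T.fderiv]
  exact (T.opNorm_comp_le _).trans (mul_le_of_le_one_left (norm_nonneg _) hT)

/-- The Gagliardo-Nirenberg-Sobolev inequality for functions valued in multilinear maps into a
Hilbert space, with a constant that does not depend on this Hilbert space. -/
theorem eLpNorm_le_eLpNorm_fderiv_of_eq_multilinear (b : OrthonormalBasis ι ℝ E)
    (μ : Measure E) [μ.IsAddHaarMeasure] {n : ℕ}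
    {G : E → ContinuousMultilinearMap ℝ (fun _ : Fin n ↦ E) F}
    (hG : ContDiff ℝ 1 G) (h2G : HasCompactSupport G)
    {p p' : ℝ≥0} (hp : 1 ≤ p) (h1p' : 1 ≤ p') (hn : 0 < Module.finrank ℝ E)
    (hp' : (p' : ℝ)⁻¹ = p⁻¹ - (Module.finrank ℝ E : ℝ)⁻¹) :
    eLpNorm G p' μ ≤ (Fintype.card (Fin n → ι) * eLpNormLESNormFDerivOfEqInnerConst μ p : ℝ≥0) *
      eLpNorm (fderiv ℝ G) p μ := by
  set C := eLpNormLESNormFDerivOfEqInnerConst μ p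
  let ev (r : Fin n → ι) : ContinuousMultilinearMap ℝ (fun _ : Fin n ↦ E) F →L[ℝ] F :=
    ContinuousMultilinearMap.apply ℝ (fun _ : Fin n ↦ E) F fun k ↦ b (r k)
  have hev (r) : ‖ev r‖ ≤ 1 := by
    refine ContinuousLinearMap.opNorm_le_bound _ zero_le_one fun M ↦ ?_
    simpa [ev] using M.le_opNorm fun k ↦ b (r k)
  have hcomp (r) : ContDiff ℝ 1 (ev r ∘ G) := (ev r).contDiff.comp hG
  have hsob (r) : eLpNorm (ev r ∘ G) p' μ ≤ C * eLpNorm (fderiv ℝ G) p μ :=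
    eLpNorm_clm_comp_le_eLpNorm_fderiv_of_eq μ (hev r) hG h2G hp hn hp'
  calc eLpNorm G p' μ ≤ eLpNorm (∑ r, fun x ↦ ‖(ev r ∘ G) x‖) p' μ := by
        refine eLpNorm_mono_real fun x ↦ ?_
        rw [Finset.sum_apply]
        exact (G x).opNorm_le_sum_norm_orthonormalBasis b
    _ ≤ ∑ r, eLpNorm (fun x ↦ ‖(ev r ∘ G) x‖) p' μ :=
        eLpNorm_sum_le (fun r _ ↦ (hcomp r).continuous.norm.aestronglyMeasurable)
          (by exact_mod_cast h1p')
    _ ≤ ∑ _r : Fin n → ι, C * eLpNorm (fderiv ℝ G) p μ := by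
        refine Finset.sum_le_sum fun r _ ↦ ?_
        rw [eLpNorm_norm]
        exact hsob r
    _ = _ := by
        rw [Finset.sum_const, Finset.card_univ, nsmul_eq_mul, ENNReal.coe_mul, mul_assoc,
          ENNReal.coe_natCast]

end Multilinear

theorem sqrt_integral_norm_pow_four_le_of_eLpNorm_le {X V W : Type*} [MeasurableSpace X]
    [NormedAddCommGroup V] [NormedAddCommGroup W] {μ : Measure X} {G : X → V} {H : X → W}
    (hG : MemLp G 4 μ) (hH : MemLp H 2 μ) {C : ℝ≥0} (h : eLpNorm G 4 μ ≤ C * eLpNorm H 2 μ) :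
    Real.sqrt (∫ x, ‖G x‖ ^ 4 ∂μ) ≤ C ^ 2 * ∫ x, ‖H x‖ ^ 2 ∂μ := by
  rw [hG.eLpNorm_eq_integral_rpow_norm (by norm_num) (by norm_num),
    hH.eLpNorm_eq_integral_rpow_norm (by norm_num) (by norm_num), ← ENNReal.ofReal_coe_nnreal,
    ← ENNReal.ofReal_mul C.coe_nonneg, ENNReal.ofReal_le_ofReal_iff (by positivity)] at h
  norm_num at h
  set a := ∫ x, ‖G x‖ ^ 4 ∂μ
  set c := ∫ x, ‖H x‖ ^ 2 ∂μ
  have ha : 0 ≤ a := by positivity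
  have hc : 0 ≤ c := by positivity
  have h2 := pow_le_pow_left₀ (by positivity) h 2
  rw [mul_pow, ← Real.rpow_natCast, ← Real.rpow_mul ha, ← Real.rpow_natCast (c ^ _),
    ← Real.rpow_mul hc] at h2
  norm_num at h2
  rwa [Real.sqrt_eq_rpow]

theorem setIntegral_sq_mul_sq_le {X : Type*} [TopologicalSpace X] [T2Space X] [MeasurableSpace X]
    [OpensMeasurableSpace X] {μ : Measure X} [IsFiniteMeasureOnCompacts μ] {K : Set X}
    (hK : IsCompact K) {u v : X → ℝ} (hu : Continuous u) (hv : Continuous v) :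
    ∫ x in K, u x ^ 2 * v x ^ 2 ∂μ ≤
      Real.sqrt (∫ x in K, u x ^ 4 ∂μ) * Real.sqrt (∫ x in K, v x ^ 4 ∂μ) := by
  have hmem {w : X → ℝ} (hw : Continuous w) :
      MemLp (fun x ↦ w x ^ 2) (ENNReal.ofReal 2) (μ.restrict K) := by
    rw [ENNReal.ofReal_ofNat, memLp_two_iff_integrable_sq]
    · exact ((hw.pow 2).pow 2).continuousOn.integrableOn_compact hK
    · exact (hw.pow 2).continuousOn.aestronglyMeasurable_of_isCompact hK hK.measurableSet
  have h := integral_mul_le_Lp_mul_Lq_of_nonneg (μ := μ.restrict K) Real.HolderConjugate.two_two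
    (.of_forall fun x ↦ sq_nonneg (u x)) (.of_forall fun x ↦ sq_nonneg (v x)) (hmem hu) (hmem hv)
  simpa [Real.sqrt_eq_rpow, ← pow_mul] using h

theorem norm_fderiv_sq_smul_sq_le {E V : Type*} [NormedAddCommGroup E] [NormedSpace ℝ E]
    [NormedAddCommGroup V] [NormedSpace ℝ V] {φ : E → ℝ} {g : E → V} {x : E}
    (hφ : DifferentiableAt ℝ φ x) (hg : DifferentiableAt ℝ g x) :
    ‖fderiv ℝ (fun y ↦ φ y ^ 2 • g y) x‖ ^ 2 ≤
      8 * (‖fderiv ℝ g x‖ ^ 2 * φ x ^ 4 + ‖g x‖ ^ 2 * φ x ^ 2 * ‖fderiv ℝ φ x‖ ^ 2) := by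
  have h : ‖fderiv ℝ (fun y ↦ φ y ^ 2 • g y) x‖ ≤
      φ x ^ 2 * ‖fderiv ℝ g x‖ + 2 * |φ x| * ‖fderiv ℝ φ x‖ * ‖g x‖ := by
    rw [fderiv_fun_smul (hφ.fun_pow 2) hg, fderiv_fun_pow 2 hφ]
    refine (norm_add_le _ _).trans (add_le_add ?_ ?_)
    · simp [norm_smul]
    · simp [ContinuousLinearMap.norm_smulRight_apply, norm_smul]
  refine (pow_le_pow_left₀ (norm_nonneg _) h 2).trans ?_
  have h1 : (2 * |φ x| * ‖fderiv ℝ φ x‖ * ‖g x‖) ^ 2 =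
      4 * (‖g x‖ ^ 2 * φ x ^ 2 * ‖fderiv ℝ φ x‖ ^ 2) := by
    rw [mul_pow, mul_pow, mul_pow, sq_abs]
    ring
  have h2 : (φ x ^ 2 * ‖fderiv ℝ g x‖) ^ 2 = ‖fderiv ℝ g x‖ ^ 2 * φ x ^ 4 := by ring
  have h3 : 0 ≤ ‖fderiv ℝ g x‖ ^ 2 * φ x ^ 4 := by positivity
  refine add_sq_le.trans ?_
  rw [h1, h2]
  linarith

/-- Inequality (nabla sq f) of the Sobolev lemma on `ℝ⁴`: there is a universal `C > 0`
such that for every smooth `f : ℝ⁴ → ℝ^L` and smooth compactly supported `φ`,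
`∫ |∇df|²|df|²φ⁴ ≤ C (∫_{supp φ} |df|⁴)^{1/2} (∫ |∇²df|²φ⁴ + ∫ |∇df|²φ²|∇φ|²)`. -/
theorem stmt_9 : ∃ C > (0:ℝ), ∀ (L : ℕ), 1 ≤ L →
    ∀ f : EuclideanSpace ℝ (Fin 4) → EuclideanSpace ℝ (Fin L), ContDiff ℝ (⊤ : ℕ∞) f →
    ∀ φ : EuclideanSpace ℝ (Fin 4) → ℝ, ContDiff ℝ (⊤ : ℕ∞) φ → HasCompactSupport φ →
    ∫ x, ‖iteratedFDeriv ℝ 2 f x‖ ^ 2 * ‖fderiv ℝ f x‖ ^ 2 * φ x ^ 4 ≤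
      C * Real.sqrt (∫ x in tsupport φ, ‖fderiv ℝ f x‖ ^ 4) *
        ((∫ x, ‖iteratedFDeriv ℝ 3 f x‖ ^ 2 * φ x ^ 4) +
          ∫ x, ‖iteratedFDeriv ℝ 2 f x‖ ^ 2 * φ x ^ 2 * ‖fderiv ℝ φ x‖ ^ 2) := by
  obtain ⟨S, hS⟩ : ∃ S : ℝ≥0, S = Fintype.card (Fin 2 → Fin 4) *
    eLpNormLESNormFDerivOfEqInnerConst (volume : Measure (EuclideanSpace ℝ (Fin 4))) (2 : ℝ≥0) :=
    ⟨_, rfl⟩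
  refine ⟨8 * S ^ 2 + 1, by positivity, fun L _ f hf φ hφ hφc ↦ ?_⟩
  have hD2 : ContDiff ℝ 1 (iteratedFDeriv ℝ 2 f) :=
    hf.iteratedFDeriv_right (by norm_cast)
  have hφ1 : ContDiff ℝ 1 φ := hφ.of_le (by exact_mod_cast le_top)
  have hdf : Continuous (fderiv ℝ f) := hf.continuous_fderiv (by simp)
  have hdφ : Continuous (fderiv ℝ φ) := hφ1.continuous_fderiv one_ne_zero
  have hD3 : Continuous (iteratedFDeriv ℝ 3 f) :=
    hf.continuous_iteratedFDeriv (by norm_cast)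
  set G := fun x ↦ φ x ^ 2 • iteratedFDeriv ℝ 2 f x with hGdef
  have hG : ContDiff ℝ 1 G := (hφ1.pow 2).smul hD2
  have hφ0 {x} (hx : x ∉ tsupport φ) : φ x = 0 := image_eq_zero_of_notMem_tsupport hx
  have hGc : HasCompactSupport G := .intro hφc fun x hx ↦ by simp [hGdef, hφ0 hx]
  have hsob : eLpNorm G 4 volume ≤ S * eLpNorm (fderiv ℝ G) 2 volume := by
    have := eLpNorm_le_eLpNorm_fderiv_of_eq_multilinear (EuclideanSpace.basisFun (Fin 4) ℝ) volume
      hG hGc (p := 2) (p' := 4) (by norm_num) (by norm_num) (by simp) (by simp; norm_num)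
    rw [hS]
    exact_mod_cast this
  have hsqrt := sqrt_integral_norm_pow_four_le_of_eLpNorm_le
    (hG.continuous.memLp_of_hasCompactSupport hGc)
    ((hG.continuous_fderiv one_ne_zero).memLp_of_hasCompactSupport (hGc.fderiv ℝ)) hsob
  have hint3 : Integrable fun x ↦ ‖iteratedFDeriv ℝ 3 f x‖ ^ 2 * φ x ^ 4 :=
    ((hD3.norm.pow 2).mul (hφ1.continuous.pow 4)).integrable_of_hasCompactSupport
      (.intro hφc fun x hx ↦ by simp [hφ0 hx])
  have hint2 : Integrable fun x ↦
      ‖iteratedFDeriv ℝ 2 f x‖ ^ 2 * φ x ^ 2 * ‖fderiv ℝ φ x‖ ^ 2 :=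
    (((hD2.continuous.norm.pow 2).mul (hφ1.continuous.pow 2)).mul
      (hdφ.norm.pow 2)).integrable_of_hasCompactSupport
        (.intro hφc fun x hx ↦ by simp [hφ0 hx])
  have hgrad : ∫ x, ‖fderiv ℝ G x‖ ^ 2 ≤ 8 * ((∫ x, ‖iteratedFDeriv ℝ 3 f x‖ ^ 2 * φ x ^ 4) +
      ∫ x, ‖iteratedFDeriv ℝ 2 f x‖ ^ 2 * φ x ^ 2 * ‖fderiv ℝ φ x‖ ^ 2) := by
    rw [← integral_add hint3 hint2, ← integral_const_mul]
    refine integral_mono_of_nonneg (.of_forall fun x ↦ by positivity)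
      ((hint3.add hint2).const_mul 8) (.of_forall fun x ↦ ?_)
    have := norm_fderiv_sq_smul_sq_le (hφ1.differentiable one_ne_zero x)
      (hD2.differentiable one_ne_zero x)
    rwa [norm_fderiv_iteratedFDeriv] at this
  have hG4 : ∫ x in tsupport φ, ‖G x‖ ^ 4 = ∫ x, ‖G x‖ ^ 4 :=
    setIntegral_eq_integral_of_forall_compl_eq_zero fun x hx ↦ by simp [hGdef, hφ0 hx]
  set R := (∫ x, ‖iteratedFDeriv ℝ 3 f x‖ ^ 2 * φ x ^ 4) +
      ∫ x, ‖iteratedFDeriv ℝ 2 f x‖ ^ 2 * φ x ^ 2 * ‖fderiv ℝ φ x‖ ^ 2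
  have hR : 0 ≤ R := by positivity
  calc ∫ x, ‖iteratedFDeriv ℝ 2 f x‖ ^ 2 * ‖fderiv ℝ f x‖ ^ 2 * φ x ^ 4
      = ∫ x, ‖G x‖ ^ 2 * ‖fderiv ℝ f x‖ ^ 2 := by
        refine integral_congr_ae (.of_forall fun x ↦ ?_)
        simp only [hGdef, norm_smul, norm_pow, Real.norm_eq_abs, sq_abs]
        ring
    _ = ∫ x in tsupport φ, ‖G x‖ ^ 2 * ‖fderiv ℝ f x‖ ^ 2 :=
        (setIntegral_eq_integral_of_forall_compl_eq_zero fun x hx ↦ by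
          simp [hGdef, hφ0 hx]).symm
    _ ≤ Real.sqrt (∫ x in tsupport φ, ‖G x‖ ^ 4) *
          Real.sqrt (∫ x in tsupport φ, ‖fderiv ℝ f x‖ ^ 4) :=
        setIntegral_sq_mul_sq_le hφc hG.continuous.norm hdf.norm
    _ ≤ ((8 * S ^ 2 + 1) * R) * Real.sqrt (∫ x in tsupport φ, ‖fderiv ℝ f x‖ ^ 4) := by
        rw [hG4]
        gcongr
        calc _ ≤ S ^ 2 * ∫ x, ‖fderiv ℝ G x‖ ^ 2 := hsqrt
          _ ≤ S ^ 2 * (8 * R) := by gcongr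
          _ ≤ (8 * S ^ 2 + 1) * R := by linarith
    _ = _ := by ring
end

section
/- There exists a constant $C > 0$ such that for every $L \ge 1$, every smooth map $f : \mathbb{R}^4 \to \mathbb{R}^L$, and every smooth compactly supported function $\varphi : \mathbb{R}^4 \to \mathbb{R}$, $\left( \int_{\mathbb{R}^4} |df|^8 \varphi^8 \right)^{1/2} \le C \left( \int_{\mathrm{supp}\,\varphi} |df|^4 \right)^{1/2} \left( \int_{\mathbb{R}^4} |\nabla^2 df|^2 \varphi^4 + \int_{\mathbb{R}^4} |\nabla df|^2 \varphi^2 |\nabla \varphi|^2 \right) + C \int_{\mathbb{R}^4} |df|^4 \varphi^2 |\nabla \varphi|^2$. -/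
open MeasureTheory

theorem exists_sqrt_integral_norm_pow_four_le :
    ∃ S : ℝ, 0 ≤ S ∧ ∀ (H : Type) [NormedAddCommGroup H] [InnerProductSpace ℝ H]
      (u : EuclideanSpace ℝ (Fin 4) → H), ContDiff ℝ 1 u → HasCompactSupport u →
      Real.sqrt (∫ x, ‖u x‖ ^ 4) ≤ S * ∫ x, ‖fderiv ℝ u x‖ ^ 2 := by
  let K := eLpNormLESNormFDerivOfEqInnerConst
    (volume : Measure (EuclideanSpace ℝ (Fin 4))) (2 : NNReal)
  refine ⟨(K : ℝ) ^ 2, by positivity, fun H _ _ u hu hc => ?_⟩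
  have sobolev := eLpNorm_le_eLpNorm_fderiv_of_eq_inner
    (volume : Measure (EuclideanSpace ℝ (Fin 4))) hu hc (p := 2) (p' := 4) (by norm_num)
    (by simp) (by simp; norm_num)
  have hdu : MemLp (fderiv ℝ u) 2 volume :=
    (hu.continuous_fderiv one_ne_zero).memLp_of_hasCompactSupport (hc.fderiv ℝ)
  have hu4 : MemLp u 4 volume := hu.continuous.memLp_of_hasCompactSupport hc
  have real_sobolev := ENNReal.toReal_mono
    (ENNReal.mul_ne_top ENNReal.coe_ne_top hdu.eLpNorm_ne_top) sobolev
  have norm_four : (eLpNorm u 4 volume).toReal ^ 4 = ∫ x, ‖u x‖ ^ 4 := by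
    have hI : 0 ≤ ∫ x, ‖u x‖ ^ 4 := integral_nonneg fun x => by positivity
    rw [hu4.eLpNorm_eq_integral_rpow_norm (by norm_num) (by norm_num)]
    have : (4 : ENNReal).toReal = (4 : ℕ) := by norm_num
    simp only [this, Real.rpow_natCast]
    rw [ENNReal.toReal_ofReal (by positivity), Real.rpow_inv_natCast_pow hI (by norm_num)]
  have norm_two : (eLpNorm (fderiv ℝ u) 2 volume).toReal ^ 2 = ∫ x, ‖fderiv ℝ u x‖ ^ 2 := by
    have hI : 0 ≤ ∫ x, ‖fderiv ℝ u x‖ ^ 2 := integral_nonneg fun x => by positivity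
    rw [hdu.eLpNorm_eq_integral_rpow_norm (by norm_num) (by norm_num)]
    have : (2 : ENNReal).toReal = (2 : ℕ) := by norm_num
    simp only [this, Real.rpow_natCast]
    rw [ENNReal.toReal_ofReal (by positivity), Real.rpow_inv_natCast_pow hI (by norm_num)]
  rw [← norm_four, ← norm_two, ← mul_pow]
  rw [ENNReal.toReal_mul] at real_sobolev
  rw [show (eLpNorm u 4 volume).toReal ^ 4 = ((eLpNorm u 4 volume).toReal ^ 2) ^ 2 by ring,
    Real.sqrt_sq (by positivity)]
  exact pow_le_pow_left₀ ENNReal.toReal_nonneg real_sobolev 2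

theorem integrable_of_continuous_of_eq_zero {E : Type*} [TopologicalSpace E] [MeasurableSpace E]
    [OpensMeasurableSpace E] {μ : Measure E} [IsFiniteMeasureOnCompacts μ]
    {φ F : E → ℝ} (hF : Continuous F) (hφ : HasCompactSupport φ)
    (h : ∀ x, φ x = 0 → F x = 0) : Integrable F μ :=
  hF.integrable_of_hasCompactSupport (hφ.mono fun x hx hx' => hx (h x hx'))

theorem ContinuousLinearMap.opNorm_le_sum_norm_apply_single {ι H : Type*} [Fintype ι]
    [DecidableEq ι] [NormedAddCommGroup H] [NormedSpace ℝ H] (T : EuclideanSpace ℝ ι →L[ℝ] H) :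
    ‖T‖ ≤ ∑ i, ‖T (EuclideanSpace.single i 1)‖ := by
  refine T.opNorm_le_bound (Finset.sum_nonneg fun i _ => norm_nonneg _) fun x => ?_
  have hx : x = ∑ i, x i • EuclideanSpace.single i (1 : ℝ) := by
    simpa using ((EuclideanSpace.basisFun ι ℝ).sum_repr x).symm
  conv_lhs => rw [hx]
  rw [map_sum, Finset.sum_mul]
  refine norm_sum_le_of_le _ fun i _ => ?_
  rw [map_smul, norm_smul, mul_comm]
  gcongr
  exact PiLp.norm_apply_le x i

theorem sqrt_integral_opNorm_pow_mul_le {H : Type*} [NormedAddCommGroup H] [NormedSpace ℝ H]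
    {G : EuclideanSpace ℝ (Fin 4) → EuclideanSpace ℝ (Fin 4) →L[ℝ] H} (hG : Continuous G)
    {ψ : EuclideanSpace ℝ (Fin 4) → ℝ} (hψ : Continuous ψ) (hc : HasCompactSupport ψ)
    (hψ0 : ∀ x, 0 ≤ ψ x) (m : ℕ) {B : ℝ}
    (h : ∀ i, Real.sqrt (∫ x, ‖G x (EuclideanSpace.single i 1)‖ ^ (m + 1) * ψ x) ≤ B) :
    Real.sqrt (∫ x, ‖G x‖ ^ (m + 1) * ψ x) ≤ 2 ^ (m + 1) * B := by
  have hB : 0 ≤ B := (Real.sqrt_nonneg _).trans (h 0)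
  have hint (i : Fin 4) :
      Integrable fun x => ‖G x (EuclideanSpace.single i 1)‖ ^ (m + 1) * ψ x :=
    integrable_of_continuous_of_eq_zero (by fun_prop) hc (by simp +contextual)
  have pointwise (x) : ‖G x‖ ^ (m + 1) * ψ x ≤
      4 ^ m * ∑ i, ‖G x (EuclideanSpace.single i 1)‖ ^ (m + 1) * ψ x := by
    rw [← Finset.sum_mul, ← mul_assoc]
    refine mul_le_mul_of_nonneg_right ?_ (hψ0 x)
    refine (pow_le_pow_left₀ (norm_nonneg _) (G x).opNorm_le_sum_norm_apply_single _).trans ?_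
    have := pow_sum_div_card_le_sum_pow (s := (Finset.univ : Finset (Fin 4)))
      (f := fun i => ‖G x (EuclideanSpace.single i 1)‖) (fun i _ => norm_nonneg _) m
    rw [div_le_iff₀ (by simp)] at this
    simpa [mul_comm] using this
  have bound : ∫ x, ‖G x‖ ^ (m + 1) * ψ x ≤ (2 ^ (m + 1) * B) ^ 2 := by
    calc
      _ ≤ ∫ x, 4 ^ m * ∑ i, ‖G x (EuclideanSpace.single i 1)‖ ^ (m + 1) * ψ x :=
        integral_mono
          (integrable_of_continuous_of_eq_zero (by fun_prop) hc (by simp +contextual))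
          ((integrable_finsetSum _ fun i _ => hint i).const_mul _) pointwise
      _ = 4 ^ m * ∑ i, ∫ x, ‖G x (EuclideanSpace.single i 1)‖ ^ (m + 1) * ψ x := by
        rw [integral_const_mul, integral_finsetSum _ fun i _ => hint i]
      _ ≤ 4 ^ m * ∑ _i : Fin 4, B ^ 2 := by
        gcongr with i
        exact (Real.sqrt_le_left hB).1 (h i)
      _ = (2 ^ (m + 1) * B) ^ 2 := by
        rw [mul_pow, ← pow_mul, mul_comm (m + 1), pow_mul]
        simp
        ring
  exact (Real.sqrt_le_left (by positivity)).2 bound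

theorem integral_mul_le_sqrt_mul_sqrt {α : Type*} [MeasurableSpace α] {μ : Measure α}
    {a b : α → ℝ} (ha : ∀ x, 0 ≤ a x) (hb : ∀ x, 0 ≤ b x) (ha2 : MemLp a 2 μ)
    (hb2 : MemLp b 2 μ) :
    ∫ x, a x * b x ∂μ ≤ Real.sqrt (∫ x, a x ^ 2 ∂μ) * Real.sqrt (∫ x, b x ^ 2 ∂μ) := by
  have := integral_mul_le_Lp_mul_Lq_of_nonneg (μ := μ) (p := 2) (q := 2)
    Real.HolderConjugate.two_two (.of_forall ha) (.of_forall hb) (by simpa using ha2)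
    (by simpa using hb2)
  simpa [Real.sqrt_eq_rpow] using this

section Products

variable {E H : Type*} [NormedAddCommGroup E] [NormedSpace ℝ E]

theorem norm_fderiv_sq_smul_le [NormedAddCommGroup H] [NormedSpace ℝ H] {φ : E → ℝ} {h : E → H}
    {x : E} (hφ : DifferentiableAt ℝ φ x) (hh : DifferentiableAt ℝ h x) :
    ‖fderiv ℝ (fun y => φ y ^ 2 • h y) x‖ ≤
      ‖fderiv ℝ h x‖ * φ x ^ 2 + 2 * (‖h x‖ * |φ x| * ‖fderiv ℝ φ x‖) := by
  rw [fderiv_fun_smul (hφ.fun_pow 2) hh, fderiv_fun_pow 2 hφ]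
  refine (norm_add_le _ _).trans (add_le_add ?_ ?_)
  · rw [norm_smul, Real.norm_eq_abs, abs_of_nonneg (by positivity), mul_comm]
  · refine (ContinuousLinearMap.norm_smulRight_apply _ _).le.trans ?_
    rw [norm_smul]
    simp only [Nat.add_one_sub_one, pow_one, nsmul_eq_mul, Nat.cast_ofNat, norm_mul,
      Real.norm_ofNat, Real.norm_eq_abs]
    apply le_of_eq
    ring

theorem norm_fderiv_norm_sq_le [NormedAddCommGroup H] [InnerProductSpace ℝ H] {g : E → H} {x : E}
    (hg : DifferentiableAt ℝ g x) :
    ‖fderiv ℝ (fun y => ‖g y‖ ^ 2) x‖ ≤ 2 * (‖g x‖ * ‖fderiv ℝ g x‖) := by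
  rw [hg.hasFDerivAt.norm_sq.fderiv, ← Nat.cast_smul_eq_nsmul ℝ, norm_smul]
  simp only [Nat.cast_ofNat, Real.norm_ofNat]
  gcongr
  exact (ContinuousLinearMap.opNorm_comp_le _ _).trans (by simp)

theorem norm_iteratedFDeriv_fderiv_apply_le [NormedAddCommGroup H] [NormedSpace ℝ H] {f : E → H}
    (hf : ContDiff ℝ (⊤ : ℕ∞) f) (n : ℕ) {e : E} (he : ‖e‖ ≤ 1) (x : E) :
    ‖iteratedFDeriv ℝ n (fun y => fderiv ℝ f y e) x‖ ≤ ‖iteratedFDeriv ℝ (n + 1) f x‖ := by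
  have hdf : ContDiff ℝ (⊤ : ℕ∞) (fderiv ℝ f) := hf.fderiv_right (by simp)
  have := (ContinuousLinearMap.apply ℝ H e).norm_iteratedFDeriv_comp_left
    (hdf.contDiffAt (x := x)) (n := n) (by exact_mod_cast le_top)
  rw [norm_iteratedFDeriv_fderiv] at this
  refine this.trans (mul_le_of_le_one_left (norm_nonneg _) ?_)
  refine ContinuousLinearMap.opNorm_le_bound _ zero_le_one fun T => ?_
  simpa using T.le_of_opNorm_le_of_le le_rfl he

end Products

theorem exists_sqrt_integral_norm_pow_four_mul_pow_eight_le :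
    ∃ S : ℝ, 0 ≤ S ∧ ∀ (H : Type) [NormedAddCommGroup H] [InnerProductSpace ℝ H]
      (h : EuclideanSpace ℝ (Fin 4) → H), ContDiff ℝ 1 h →
      ∀ φ : EuclideanSpace ℝ (Fin 4) → ℝ, ContDiff ℝ 1 φ → HasCompactSupport φ →
      Real.sqrt (∫ x, ‖h x‖ ^ 4 * φ x ^ 8) ≤
        S * ((∫ x, ‖fderiv ℝ h x‖ ^ 2 * φ x ^ 4) +
          ∫ x, ‖h x‖ ^ 2 * φ x ^ 2 * ‖fderiv ℝ φ x‖ ^ 2) := by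
  obtain ⟨S, hS, sobolev⟩ := exists_sqrt_integral_norm_pow_four_le
  refine ⟨8 * S, by positivity, fun H _ _ h hh φ hφ hc => ?_⟩
  have hh0 := hh.continuous
  have hφ0 := hφ.continuous
  have hh1 := hh.continuous_fderiv one_ne_zero
  have hφ1 := hφ.continuous_fderiv one_ne_zero
  have hu : ContDiff ℝ 1 fun y => φ y ^ 2 • h y := (hφ.pow 2).smul hh
  have huc : HasCompactSupport fun y => φ y ^ 2 • h y :=
    hc.mono fun x hx hx' => hx (by simp [hx'])
  have hint1 : Integrable fun x => ‖fderiv ℝ h x‖ ^ 2 * φ x ^ 4 :=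
    integrable_of_continuous_of_eq_zero (by fun_prop) hc (by simp +contextual)
  have hint2 : Integrable fun x => ‖h x‖ ^ 2 * φ x ^ 2 * ‖fderiv ℝ φ x‖ ^ 2 :=
    integrable_of_continuous_of_eq_zero (by fun_prop) hc (by simp +contextual)
  have hu1 := hu.continuous_fderiv one_ne_zero
  have bound : ∫ x, ‖fderiv ℝ (fun y => φ y ^ 2 • h y) x‖ ^ 2 ≤
      8 * ((∫ x, ‖fderiv ℝ h x‖ ^ 2 * φ x ^ 4) +
        ∫ x, ‖h x‖ ^ 2 * φ x ^ 2 * ‖fderiv ℝ φ x‖ ^ 2) := by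
    rw [← integral_add hint1 hint2, ← integral_const_mul]
    refine integral_mono ?_ ((hint1.add hint2).const_mul 8) fun x => ?_
    · refine (hu1.norm.pow 2).integrable_of_hasCompactSupport ?_
      exact (huc.fderiv ℝ).mono fun x hx hx' => hx (by simp [hx'])
    · have := norm_fderiv_sq_smul_le (hφ.differentiable one_ne_zero x)
        (hh.differentiable one_ne_zero x)
      refine (pow_le_pow_left₀ (norm_nonneg _) this 2).trans ?_
      refine add_sq_le.trans (le_of_sub_nonneg ?_)
      simp only [mul_pow, sq_abs]
      have : 0 ≤ ‖fderiv ℝ h x‖ ^ 2 * φ x ^ 4 := by positivity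
      linarith
  have key := sobolev H _ hu huc
  have hpow (x) : ‖φ x ^ 2 • h x‖ ^ 4 = ‖h x‖ ^ 4 * φ x ^ 8 := by
    rw [norm_smul, norm_pow, Real.norm_eq_abs, sq_abs]
    ring
  simp only [hpow] at key
  calc
    _ ≤ _ := key
    _ ≤ _ := mul_le_mul_of_nonneg_left bound hS
    _ = _ := by ring

theorem exists_sqrt_integral_norm_pow_eight_mul_pow_eight_le :
    ∃ S : ℝ, 0 ≤ S ∧ ∀ (H : Type) [NormedAddCommGroup H] [InnerProductSpace ℝ H]
      (g : EuclideanSpace ℝ (Fin 4) → H), ContDiff ℝ 1 g →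
      ∀ φ : EuclideanSpace ℝ (Fin 4) → ℝ, ContDiff ℝ 1 φ → HasCompactSupport φ →
      Real.sqrt (∫ x, ‖g x‖ ^ 8 * φ x ^ 8) ≤
        S * ((∫ x, ‖g x‖ ^ 2 * (‖fderiv ℝ g x‖ ^ 2 * φ x ^ 4)) +
          ∫ x, ‖g x‖ ^ 4 * φ x ^ 2 * ‖fderiv ℝ φ x‖ ^ 2) := by
  obtain ⟨S, hS, sobolev⟩ := exists_sqrt_integral_norm_pow_four_mul_pow_eight_le
  refine ⟨4 * S, by positivity, fun H _ _ g hg φ hφ hc => ?_⟩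
  have hg0 := hg.continuous
  have hφ0 := hφ.continuous
  have hg1 := hg.continuous_fderiv one_ne_zero
  have hn : ContDiff ℝ 1 fun x => ‖g x‖ ^ 2 := hg.norm_sq ℝ
  have hn1 := hn.continuous_fderiv one_ne_zero
  have bound : ∫ x, ‖fderiv ℝ (fun y => ‖g y‖ ^ 2) x‖ ^ 2 * φ x ^ 4 ≤
      4 * ∫ x, ‖g x‖ ^ 2 * (‖fderiv ℝ g x‖ ^ 2 * φ x ^ 4) := by
    rw [← integral_const_mul]
    refine integral_mono
      (integrable_of_continuous_of_eq_zero (by fun_prop) hc (by simp +contextual))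
      (integrable_of_continuous_of_eq_zero (by fun_prop) hc (by simp +contextual)) fun x => ?_
    have := pow_le_pow_left₀ (norm_nonneg _)
      (norm_fderiv_norm_sq_le (hg.differentiable one_ne_zero x)) 2
    refine (mul_le_mul_of_nonneg_right this (by positivity)).trans_eq ?_
    ring
  have hnonneg : 0 ≤ ∫ x, ‖g x‖ ^ 4 * φ x ^ 2 * ‖fderiv ℝ φ x‖ ^ 2 :=
    integral_nonneg fun x => by positivity
  have key := sobolev ℝ _ hn φ hφ hc
  simp only [norm_pow, norm_norm, ← pow_mul, Nat.reduceMul] at key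
  refine key.trans ?_
  rw [mul_comm 4 S, mul_assoc]
  refine mul_le_mul_of_nonneg_left ?_ hS
  linarith

/-- Inequality (df^8) of the Sobolev lemma on `ℝ⁴`: there is a universal `C > 0` such that
for every smooth `f : ℝ⁴ → ℝ^L` and smooth compactly supported `φ`,
`(∫ |df|⁸φ⁸)^{1/2} ≤ C (∫_{supp φ} |df|⁴)^{1/2} (∫ |∇²df|²φ⁴ + ∫ |∇df|²φ²|∇φ|²)
  + C ∫ |df|⁴φ²|∇φ|²`. -/
theorem stmt_10 : ∃ C > (0:ℝ), ∀ (L : ℕ), 1 ≤ L →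
    ∀ f : EuclideanSpace ℝ (Fin 4) → EuclideanSpace ℝ (Fin L), ContDiff ℝ (⊤ : ℕ∞) f →
    ∀ φ : EuclideanSpace ℝ (Fin 4) → ℝ, ContDiff ℝ (⊤ : ℕ∞) φ → HasCompactSupport φ →
    Real.sqrt (∫ x, ‖fderiv ℝ f x‖ ^ 8 * φ x ^ 8) ≤
      C * Real.sqrt (∫ x in tsupport φ, ‖fderiv ℝ f x‖ ^ 4) *
        ((∫ x, ‖iteratedFDeriv ℝ 3 f x‖ ^ 2 * φ x ^ 4) +
          ∫ x, ‖iteratedFDeriv ℝ 2 f x‖ ^ 2 * φ x ^ 2 * ‖fderiv ℝ φ x‖ ^ 2) +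
      C * ∫ x, ‖fderiv ℝ f x‖ ^ 4 * φ x ^ 2 * ‖fderiv ℝ φ x‖ ^ 2 := by
  obtain ⟨S, hS, sobolev_four⟩ := exists_sqrt_integral_norm_pow_four_mul_pow_eight_le
  obtain ⟨T, hT, sobolev_eight⟩ := exists_sqrt_integral_norm_pow_eight_mul_pow_eight_le
  refine ⟨256 * T * (16 * S + 1) + 1, by positivity, fun L _ f hf φ hφ hc => ?_⟩
  set P := ∫ x, ‖fderiv ℝ f x‖ ^ 4 * φ x ^ 2 * ‖fderiv ℝ φ x‖ ^ 2
  set D := (∫ x, ‖iteratedFDeriv ℝ 3 f x‖ ^ 2 * φ x ^ 4) +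
    ∫ x, ‖iteratedFDeriv ℝ 2 f x‖ ^ 2 * φ x ^ 2 * ‖fderiv ℝ φ x‖ ^ 2
  set Q := Real.sqrt (∫ x in tsupport φ, ‖fderiv ℝ f x‖ ^ 4)
  have hP : 0 ≤ P := integral_nonneg fun x => by positivity
  have hD : 0 ≤ D :=
    add_nonneg (integral_nonneg fun x => by positivity) (integral_nonneg fun x => by positivity)
  have hQ : 0 ≤ Q := Real.sqrt_nonneg _
  let e (i : Fin 4) : EuclideanSpace ℝ (Fin 4) := EuclideanSpace.single i 1
  have he (i : Fin 4) : ‖e i‖ ≤ 1 := by simp [e]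
  let g (i : Fin 4) := fun x => fderiv ℝ f x (e i)
  let h (i j : Fin 4) := fun x => fderiv ℝ (g i) x (e j)
  have hg (i) : ContDiff ℝ (⊤ : ℕ∞) (g i) := (hf.fderiv_right (by simp)).clm_apply contDiff_const
  have hh (i j) : ContDiff ℝ (⊤ : ℕ∞) (h i j) :=
    ((hg i).fderiv_right (by simp)).clm_apply contDiff_const
  have hdf0 : Continuous (fderiv ℝ f) := hf.continuous_fderiv (by simp)
  have hdg0 (i) : Continuous (fderiv ℝ (g i)) := (hg i).continuous_fderiv (by simp)
  have hdh0 (i j) : Continuous (fderiv ℝ (h i j)) := (hh i j).continuous_fderiv (by simp)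
  have hg0 (i) := (hg i).continuous
  have hh0 (i j) := (hh i j).continuous
  have hφ0 := hφ.continuous
  have hdφ0 : Continuous (fderiv ℝ φ) := hφ.continuous_fderiv (by simp)
  have hfn (n : ℕ) : Continuous (iteratedFDeriv ℝ n f) :=
    hf.continuous_iteratedFDeriv (by exact_mod_cast le_top)
  have hf2 := hfn 2
  have hf3 := hfn 3
  have g_le (i x) : ‖g i x‖ ≤ ‖fderiv ℝ f x‖ := by
    simpa [norm_iteratedFDeriv_one] using norm_iteratedFDeriv_fderiv_apply_le hf 0 (he i) x
  have h_le (i j x) : ‖h i j x‖ ≤ ‖iteratedFDeriv ℝ 2 f x‖ := by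
    refine le_trans ?_ (norm_iteratedFDeriv_fderiv_apply_le hf 1 (he i) x)
    simpa using norm_iteratedFDeriv_fderiv_apply_le (hg i) 0 (he j) x
  have dh_le (i j x) : ‖fderiv ℝ (h i j) x‖ ≤ ‖iteratedFDeriv ℝ 3 f x‖ := by
    refine le_trans ?_ (norm_iteratedFDeriv_fderiv_apply_le hf 2 (he i) x)
    simpa [norm_iteratedFDeriv_one] using
      norm_iteratedFDeriv_fderiv_apply_le (hg i) 1 (he j) x
  have second (i j) : Real.sqrt (∫ x, ‖h i j x‖ ^ 4 * φ x ^ 8) ≤ S * D := by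
    refine (sobolev_four _ (h i j) ((hh i j).of_le (by simp)) φ (hφ.of_le (by simp)) hc).trans ?_
    refine mul_le_mul_of_nonneg_left (add_le_add ?_ ?_) hS
    all_goals
      refine integral_mono
        (integrable_of_continuous_of_eq_zero (by fun_prop) hc (by simp +contextual))
        (integrable_of_continuous_of_eq_zero (by fun_prop) hc (by simp +contextual)) fun x => ?_
      dsimp only
    · have := dh_le i j x
      gcongr
    · have := h_le i j x
      gcongr
  have hφ8 : HasCompactSupport fun x => φ x ^ 8 :=
    hc.mono fun x hx hx' => hx (by simp [hx'])
  have hessian (i) : Real.sqrt (∫ x, ‖fderiv ℝ (g i) x‖ ^ 4 * φ x ^ 8) ≤ 16 * (S * D) := by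
    have := sqrt_integral_opNorm_pow_mul_le (hdg0 i) (hφ0.pow 8) hφ8
      (fun x => Even.pow_nonneg (by decide) (φ x)) 3 (second i)
    norm_num at this
    exact this
  have cross (i) : ∫ x, ‖g i x‖ ^ 2 * (‖fderiv ℝ (g i) x‖ ^ 2 * φ x ^ 4) ≤
      Q * (16 * (S * D)) := by
    have hK : IsCompact (tsupport φ) := hc
    have hsupp : ∀ x ∉ tsupport φ, φ x = 0 := fun x => image_eq_zero_of_notMem_tsupport
    have memLp {a : EuclideanSpace ℝ (Fin 4) → ℝ} (ha : Continuous a) :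
        MemLp a 2 (volume.restrict (tsupport φ)) :=
      (memLp_two_iff_integrable_sq ha.aestronglyMeasurable).2
        ((ha.pow 2).continuousOn.integrableOn_compact hK)
    rw [← setIntegral_eq_integral_of_forall_compl_eq_zero (s := tsupport φ)
      fun x hx => by simp [hsupp x hx]]
    refine (integral_mul_le_sqrt_mul_sqrt (fun x => by positivity) (fun x => by positivity)
      (memLp (by fun_prop)) (memLp (by fun_prop))).trans ?_
    refine mul_le_mul (Real.sqrt_le_sqrt ?_) ?_ (Real.sqrt_nonneg _) hQ
    · refine setIntegral_mono
        (Continuous.continuousOn (by fun_prop) |>.integrableOn_compact hK)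
        (Continuous.continuousOn (by fun_prop) |>.integrableOn_compact hK) fun x => ?_
      simp only [← pow_mul, Nat.reduceMul]
      exact pow_le_pow_left₀ (norm_nonneg _) (g_le i x) 4
    · rw [setIntegral_eq_integral_of_forall_compl_eq_zero fun x hx => by simp [hsupp x hx]]
      simpa only [mul_pow, ← pow_mul, Nat.reduceMul] using hessian i
  have first (i) : Real.sqrt (∫ x, ‖g i x‖ ^ 8 * φ x ^ 8) ≤
      T * (Q * (16 * (S * D)) + P) := by
    refine (sobolev_eight _ (g i) ((hg i).of_le (by simp)) φ (hφ.of_le (by simp)) hc).trans ?_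
    refine mul_le_mul_of_nonneg_left (add_le_add (cross i) ?_) hT
    refine integral_mono
      (integrable_of_continuous_of_eq_zero (by fun_prop) hc (by simp +contextual))
      (integrable_of_continuous_of_eq_zero (by fun_prop) hc (by simp +contextual)) fun x => ?_
    have := g_le i x
    dsimp only
    gcongr
  have total := sqrt_integral_opNorm_pow_mul_le hdf0 (hφ0.pow 8) hφ8
    (fun x => Even.pow_nonneg (by decide) (φ x)) 7 first
  refine total.trans (le_of_sub_nonneg ?_)
  norm_num1
  have : 0 ≤ 256 * (T * (Q * D)) + Q * D + 4096 * (T * S * P) + P := by positivity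
  linarith
end

section
/- There exists a constant $C > 0$ such that for every $L \ge 1$, every smooth map $f : \mathbb{R}^4 \to \mathbb{R}^L$, and every smooth compactly supported function $\varphi : \mathbb{R}^4 \to \mathbb{R}$, $\int_{\mathbb{R}^4} |df|^6 \varphi^4 \le C \left( \int_{\mathrm{supp}\,\varphi} |df|^4 \right) \left( \int_{\mathbb{R}^4} |\nabla^2 df|^2 \varphi^4 + \int_{\mathbb{R}^4} |\nabla df|^2 \varphi^2 |\nabla \varphi|^2 \right) + C \left( \int_{\mathrm{supp}\,\varphi} |df|^4 \right)^{1/2} \left( \int_{\mathbb{R}^4} |df|^4 \varphi^2 |\nabla \varphi|^2 \right)$. -/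
open MeasureTheory

section IteratedFDeriv

variable {𝕜 E F : Type*} [NontriviallyNormedField 𝕜] [NormedAddCommGroup E] [NormedSpace 𝕜 E]
  [NormedAddCommGroup F] [NormedSpace 𝕜 F] (f : E → F) (x : E)

theorem norm_iteratedFDeriv_two : ‖iteratedFDeriv 𝕜 2 f x‖ = ‖fderiv 𝕜 (fderiv 𝕜 f) x‖ := by
  rw [← norm_iteratedFDeriv_fderiv, norm_iteratedFDeriv_one]

set_option maxSynthPendingDepth 3 in
theorem norm_iteratedFDeriv_three :
    ‖iteratedFDeriv 𝕜 3 f x‖ = ‖fderiv 𝕜 (fderiv 𝕜 (fderiv 𝕜 f)) x‖ := by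
  rw [← norm_iteratedFDeriv_fderiv, norm_iteratedFDeriv_two]

end IteratedFDeriv

/-- The Cauchy–Schwarz inequality for nonnegative continuous functions on a compact set. -/
theorem setIntegral_mul_le_sqrt_mul_sqrt {E : Type*} [TopologicalSpace E] [T2Space E]
    [MeasurableSpace E] [BorelSpace E] [SecondCountableTopology E] (μ : Measure E)
    [IsFiniteMeasureOnCompacts μ] {K : Set E} (hK : IsCompact K) {a b : E → ℝ}
    (ha : Continuous a) (hb : Continuous b) (ha₀ : ∀ x, 0 ≤ a x) (hb₀ : ∀ x, 0 ≤ b x) :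
    ∫ x in K, a x * b x ∂μ ≤ √(∫ x in K, a x ^ 2 ∂μ) * √(∫ x in K, b x ^ 2 ∂μ) := by
  have hmem {g : E → ℝ} (hg : Continuous g) : MemLp g (ENNReal.ofReal 2) (μ.restrict K) := by
    rw [ENNReal.ofReal_ofNat, memLp_two_iff_integrable_sq hg.aestronglyMeasurable]
    exact (hg.pow 2).continuousOn.integrableOn_compact hK
  simpa [Real.sqrt_eq_rpow] using integral_mul_le_Lp_mul_Lq_of_nonneg
    Real.HolderConjugate.two_two (.of_forall ha₀) (.of_forall hb₀) (hmem ha) (hmem hb)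

section SobolevFour

variable {E : Type*} [NormedAddCommGroup E] [NormedSpace ℝ E] [FiniteDimensional ℝ E]
  [MeasurableSpace E] [BorelSpace E] (μ : Measure E) [μ.IsAddHaarMeasure]

/-- The Sobolev embedding `W^{1,2} ⊆ L⁴` in dimension four, for maps into a Hilbert space. -/
theorem sqrt_integral_norm_pow_four_le (hE : Module.finrank ℝ E = 4)
    {H : Type*} [NormedAddCommGroup H] [InnerProductSpace ℝ H] {w : E → H}
    (hw : ContDiff ℝ 1 w) (hws : HasCompactSupport w) :
    √(∫ x, ‖w x‖ ^ 4 ∂μ) ≤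
      (eLpNormLESNormFDerivOfEqInnerConst μ 2 : ℝ) ^ 2 * ∫ x, ‖fderiv ℝ w x‖ ^ 2 ∂μ := by
  have hfd : Continuous (fderiv ℝ w) := hw.continuous_fderiv one_ne_zero
  have h := eLpNorm_le_eLpNorm_fderiv_of_eq_inner μ hw hws (p := 2) (p' := 4) (by norm_num)
    (by omega) (by rw [hE]; norm_num)
  have h₄ : eLpNorm w (4 : NNReal) μ = ENNReal.ofReal ((∫ x, ‖w x‖ ^ 4 ∂μ) ^ (4⁻¹ : ℝ)) := by
    rw [(hw.continuous.memLp_of_hasCompactSupport hws).eLpNorm_eq_integral_rpow_norm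
      (by simp) (by simp)]
    simp only [ENNReal.coe_toReal, NNReal.coe_ofNat, Real.rpow_ofNat]
  have h₂ : eLpNorm (fderiv ℝ w) (2 : NNReal) μ =
      ENNReal.ofReal ((∫ x, ‖fderiv ℝ w x‖ ^ 2 ∂μ) ^ (2⁻¹ : ℝ)) := by
    rw [(hfd.memLp_of_hasCompactSupport (hws.fderiv ℝ)).eLpNorm_eq_integral_rpow_norm
      (by simp) (by simp)]
    simp only [ENNReal.coe_toReal, NNReal.coe_ofNat, Real.rpow_ofNat]
  have hI₄ : 0 ≤ ∫ x, ‖w x‖ ^ 4 ∂μ := by positivity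
  have hI₂ : 0 ≤ ∫ x, ‖fderiv ℝ w x‖ ^ 2 ∂μ := by positivity
  rw [h₄, h₂, ← ENNReal.ofReal_coe_nnreal, ← ENNReal.ofReal_mul (by positivity),
    ENNReal.ofReal_le_ofReal_iff (by positivity)] at h
  have h' := pow_le_pow_left₀ (by positivity) h 2
  rw [mul_pow, ← Real.rpow_mul_natCast hI₄, ← Real.rpow_mul_natCast hI₂] at h'
  norm_num at h'
  rwa [Real.sqrt_eq_rpow]

variable {V H : Type*} [NormedAddCommGroup V] [NormedSpace ℝ V]
  [NormedAddCommGroup H] [InnerProductSpace ℝ H]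

/-- The cut-off Sobolev inequality for maps into a normed space `V` that is isomorphic to a
subspace of a Hilbert space. -/
theorem sqrt_integral_norm_pow_four_mul_le (hE : Module.finrank ℝ E = 4)
    (Φ : V →L[ℝ] H) {c : ℝ} (hΦ : ∀ v, ‖v‖ ≤ ‖Φ v‖) (hc : ‖Φ‖ ≤ c)
    {g : E → V} (hg : ContDiff ℝ 1 g) {φ : E → ℝ} (hφ : ContDiff ℝ 1 φ)
    (hφs : HasCompactSupport φ) :
    √(∫ x, ‖g x‖ ^ 4 * φ x ^ 8 ∂μ) ≤
      8 * c ^ 2 * (eLpNormLESNormFDerivOfEqInnerConst μ 2 : ℝ) ^ 2 *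
        ((∫ x, ‖fderiv ℝ g x‖ ^ 2 * φ x ^ 4 ∂μ) +
          ∫ x, ‖g x‖ ^ 2 * φ x ^ 2 * ‖fderiv ℝ φ x‖ ^ 2 ∂μ) := by
  have hc₀ : 0 ≤ c := (norm_nonneg Φ).trans hc
  have hgc := hg.continuous
  have hφc := hφ.continuous
  have hg'c : Continuous (fderiv ℝ g) := hg.continuous_fderiv one_ne_zero
  have hφ'c : Continuous (fderiv ℝ φ) := hφ.continuous_fderiv one_ne_zero
  have hint {a : E → ℝ} (ha : Continuous a) (h0 : ∀ x, φ x = 0 → a x = 0) : Integrable a μ :=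
    ha.integrable_of_hasCompactSupport (hφs.mono fun x hx h ↦ hx (h0 x h))
  set w : E → H := fun x ↦ φ x ^ 2 • Φ (g x) with hw_def
  have hw : ContDiff ℝ 1 w := (hφ.pow 2).smul (Φ.contDiff.comp hg)
  have hws : HasCompactSupport w := hφs.mono fun x hx h ↦ hx (by simp [hw_def, h])
  have hw' (x : E) : ‖fderiv ℝ w x‖ ^ 2 ≤ 8 * c ^ 2 * (‖fderiv ℝ g x‖ ^ 2 * φ x ^ 4 +
      ‖g x‖ ^ 2 * φ x ^ 2 * ‖fderiv ℝ φ x‖ ^ 2) := by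
    have hd := ((hφ.differentiable one_ne_zero x).hasFDerivAt.pow 2).smul
      (Φ.hasFDerivAt.comp x (hg.differentiable one_ne_zero x).hasFDerivAt)
    have hle : ‖fderiv ℝ w x‖ ≤
        c * (φ x ^ 2 * ‖fderiv ℝ g x‖ + 2 * |φ x| * ‖fderiv ℝ φ x‖ * ‖g x‖) := by
      rw [show fderiv ℝ w x = _ from hd.fderiv]
      calc _ ≤ φ x ^ 2 * ‖Φ ∘L fderiv ℝ g x‖ + 2 * |φ x| * ‖fderiv ℝ φ x‖ * ‖Φ (g x)‖ := by
            refine (norm_add_le _ _).trans_eq ?_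
            simp [norm_smul, ContinuousLinearMap.norm_smulRight_apply]
        _ ≤ φ x ^ 2 * (c * ‖fderiv ℝ g x‖) +
            2 * |φ x| * ‖fderiv ℝ φ x‖ * (c * ‖g x‖) := by
          gcongr
          · exact (Φ.opNorm_comp_le _).trans (by gcongr)
          · exact Φ.le_of_opNorm_le hc _
        _ = _ := by ring
    calc ‖fderiv ℝ w x‖ ^ 2 ≤ _ := pow_le_pow_left₀ (norm_nonneg _) hle 2
      _ ≤ c ^ 2 * (2 * ((φ x ^ 2 * ‖fderiv ℝ g x‖) ^ 2 +
          (2 * |φ x| * ‖fderiv ℝ φ x‖ * ‖g x‖) ^ 2)) := by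
        rw [mul_pow]
        gcongr
        exact add_sq_le
      _ = c ^ 2 * (2 * ‖fderiv ℝ g x‖ ^ 2 * φ x ^ 4 +
          8 * (‖g x‖ ^ 2 * φ x ^ 2 * ‖fderiv ℝ φ x‖ ^ 2)) := by
        simp only [mul_pow, sq_abs]
        ring
      _ ≤ _ := by
        have : 0 ≤ c ^ 2 * (‖fderiv ℝ g x‖ ^ 2 * φ x ^ 4) := by positivity
        linarith
  have hI₁ : Integrable (fun x ↦ ‖fderiv ℝ g x‖ ^ 2 * φ x ^ 4) μ :=
    hint (by fun_prop) fun x h ↦ by simp [h]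
  have hI₂ : Integrable (fun x ↦ ‖g x‖ ^ 2 * φ x ^ 2 * ‖fderiv ℝ φ x‖ ^ 2) μ :=
    hint (by fun_prop) fun x h ↦ by simp [h]
  calc √(∫ x, ‖g x‖ ^ 4 * φ x ^ 8 ∂μ) ≤ √(∫ x, ‖w x‖ ^ 4 ∂μ) := by
        refine Real.sqrt_le_sqrt (integral_mono (hint (by fun_prop) fun x h ↦ by simp [h])
          (hint (by fun_prop) fun x h ↦ by simp [hw_def, h]) fun x ↦ ?_)
        have : ‖w x‖ ^ 4 = ‖Φ (g x)‖ ^ 4 * φ x ^ 8 := by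
          simp only [hw_def, norm_smul, norm_pow, Real.norm_eq_abs, sq_abs]
          ring
        simp only [this]
        gcongr
        exact hΦ _
    _ ≤ _ := sqrt_integral_norm_pow_four_le μ hE hw hws
    _ ≤ (eLpNormLESNormFDerivOfEqInnerConst μ 2 : ℝ) ^ 2 *
        ∫ x, 8 * c ^ 2 * (‖fderiv ℝ g x‖ ^ 2 * φ x ^ 4 +
          ‖g x‖ ^ 2 * φ x ^ 2 * ‖fderiv ℝ φ x‖ ^ 2) ∂μ := by
        refine mul_le_mul_of_nonneg_left ?_ (by positivity)
        exact integral_mono_of_nonneg (.of_forall fun x ↦ by positivity)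
          ((hI₁.add hI₂).const_mul _) (.of_forall hw')
    _ = _ := by
        rw [integral_const_mul, integral_add hI₁ hI₂]
        ring

/-- The cut-off Sobolev inequality for the square of the norm of a map into a normed space `V`
that is isomorphic to a subspace of a Hilbert space. -/
theorem sqrt_integral_norm_pow_eight_mul_le (hE : Module.finrank ℝ E = 4)
    (Φ : V →L[ℝ] H) {c : ℝ} (hΦ : ∀ v, ‖v‖ ≤ ‖Φ v‖) (hc : ‖Φ‖ ≤ c)
    {g : E → V} (hg : ContDiff ℝ 1 g) {φ : E → ℝ} (hφ : ContDiff ℝ 1 φ)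
    (hφs : HasCompactSupport φ) :
    √(∫ x, ‖g x‖ ^ 8 * φ x ^ 8 ∂μ) ≤
      8 * c ^ 4 * (eLpNormLESNormFDerivOfEqInnerConst μ 2 : ℝ) ^ 2 *
        ((∫ x, ‖g x‖ ^ 2 * ‖fderiv ℝ g x‖ ^ 2 * φ x ^ 4 ∂μ) +
          ∫ x, ‖g x‖ ^ 4 * φ x ^ 2 * ‖fderiv ℝ φ x‖ ^ 2 ∂μ) := by
  have hc₀ : 0 ≤ c := (norm_nonneg Φ).trans hc
  have hgc := hg.continuous
  have hφc := hφ.continuous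
  have hg'c : Continuous (fderiv ℝ g) := hg.continuous_fderiv one_ne_zero
  have hφ'c : Continuous (fderiv ℝ φ) := hφ.continuous_fderiv one_ne_zero
  have hint {a : E → ℝ} (ha : Continuous a) (h0 : ∀ x, φ x = 0 → a x = 0) : Integrable a μ :=
    ha.integrable_of_hasCompactSupport (hφs.mono fun x hx h ↦ hx (h0 x h))
  set w : E → ℝ := fun x ↦ φ x ^ 2 • ‖Φ (g x)‖ ^ 2 with hw_def
  have hw : ContDiff ℝ 1 w := (hφ.pow 2).smul ((Φ.contDiff.comp hg).norm_sq ℝ)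
  have hws : HasCompactSupport w := hφs.mono fun x hx h ↦ hx (by simp [hw_def, h])
  have hw' (x : E) : ‖fderiv ℝ w x‖ ^ 2 ≤ 8 * c ^ 4 * (‖g x‖ ^ 2 * ‖fderiv ℝ g x‖ ^ 2 * φ x ^ 4 +
      ‖g x‖ ^ 4 * φ x ^ 2 * ‖fderiv ℝ φ x‖ ^ 2) := by
    have hd := ((hφ.differentiable one_ne_zero x).hasFDerivAt.pow 2).smul
      (Φ.hasFDerivAt.comp x (hg.differentiable one_ne_zero x).hasFDerivAt).norm_sq
    have hle : ‖fderiv ℝ w x‖ ≤ c ^ 2 * (φ x ^ 2 * (2 * ‖g x‖ * ‖fderiv ℝ g x‖) +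
        2 * |φ x| * ‖fderiv ℝ φ x‖ * ‖g x‖ ^ 2) := by
      rw [show fderiv ℝ w x = _ from hd.fderiv]
      calc _ ≤ φ x ^ 2 * (2 * (‖Φ (g x)‖ * ‖Φ ∘L fderiv ℝ g x‖)) +
            2 * |φ x| * ‖fderiv ℝ φ x‖ * ‖Φ (g x)‖ ^ 2 := by
            refine (norm_add_le _ _).trans (add_le_add ?_ (le_of_eq ?_))
            · rw [norm_smul, ← Nat.cast_smul_eq_nsmul ℝ, norm_smul, norm_pow, Real.norm_eq_abs,
                sq_abs]
              gcongr
              · simp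
              · exact (ContinuousLinearMap.opNorm_comp_le _ _).trans_eq (by simp)
            · simp [norm_smul, ContinuousLinearMap.norm_smulRight_apply]
        _ ≤ φ x ^ 2 * (2 * ((c * ‖g x‖) * (c * ‖fderiv ℝ g x‖))) +
            2 * |φ x| * ‖fderiv ℝ φ x‖ * (c * ‖g x‖) ^ 2 := by
          gcongr
          · exact Φ.le_of_opNorm_le hc _
          · exact (Φ.opNorm_comp_le _).trans (by gcongr)
          · exact Φ.le_of_opNorm_le hc _
        _ = _ := by ring
    calc ‖fderiv ℝ w x‖ ^ 2 ≤ _ := pow_le_pow_left₀ (norm_nonneg _) hle 2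
      _ ≤ (c ^ 2) ^ 2 * (2 * ((φ x ^ 2 * (2 * ‖g x‖ * ‖fderiv ℝ g x‖)) ^ 2 +
          (2 * |φ x| * ‖fderiv ℝ φ x‖ * ‖g x‖ ^ 2) ^ 2)) := by
        rw [mul_pow]
        gcongr
        exact add_sq_le
      _ = _ := by
        simp only [mul_pow, sq_abs]
        ring
  have hI₁ : Integrable (fun x ↦ ‖g x‖ ^ 2 * ‖fderiv ℝ g x‖ ^ 2 * φ x ^ 4) μ :=
    hint (by fun_prop) fun x h ↦ by simp [h]
  have hI₂ : Integrable (fun x ↦ ‖g x‖ ^ 4 * φ x ^ 2 * ‖fderiv ℝ φ x‖ ^ 2) μ :=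
    hint (by fun_prop) fun x h ↦ by simp [h]
  calc √(∫ x, ‖g x‖ ^ 8 * φ x ^ 8 ∂μ) ≤ √(∫ x, ‖w x‖ ^ 4 ∂μ) := by
        refine Real.sqrt_le_sqrt (integral_mono (hint (by fun_prop) fun x h ↦ by simp [h])
          (hint (by fun_prop) fun x h ↦ by simp [hw_def, h]) fun x ↦ ?_)
        have : ‖w x‖ ^ 4 = ‖Φ (g x)‖ ^ 8 * φ x ^ 8 := by
          simp only [hw_def, norm_smul, norm_pow, Real.norm_eq_abs, sq_abs]
          ring
        simp only [this]
        gcongr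
        exact hΦ _
    _ ≤ _ := sqrt_integral_norm_pow_four_le μ hE hw hws
    _ ≤ (eLpNormLESNormFDerivOfEqInnerConst μ 2 : ℝ) ^ 2 *
        ∫ x, 8 * c ^ 4 * (‖g x‖ ^ 2 * ‖fderiv ℝ g x‖ ^ 2 * φ x ^ 4 +
          ‖g x‖ ^ 4 * φ x ^ 2 * ‖fderiv ℝ φ x‖ ^ 2) ∂μ := by
        refine mul_le_mul_of_nonneg_left ?_ (by positivity)
        exact integral_mono_of_nonneg (.of_forall fun x ↦ by positivity)
          ((hI₁.add hI₂).const_mul _) (.of_forall hw')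
    _ = _ := by
        rw [integral_const_mul, integral_add hI₁ hI₂]
        ring

/-- The cut-off `L⁶` estimate obtained by interpolating the two preceding Sobolev inequalities with
the local `L⁴` norm. -/
theorem integral_norm_pow_six_mul_le (hE : Module.finrank ℝ E = 4)
    {H' : Type*} [NormedAddCommGroup H'] [InnerProductSpace ℝ H']
    (Φ : V →L[ℝ] H) {c : ℝ} (hΦ : ∀ v, ‖v‖ ≤ ‖Φ v‖) (hc : ‖Φ‖ ≤ c)
    (Ψ : (E →L[ℝ] V) →L[ℝ] H') {d : ℝ} (hΨ : ∀ T, ‖T‖ ≤ ‖Ψ T‖) (hd : ‖Ψ‖ ≤ d)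
    {g : E → V} (hg : ContDiff ℝ 2 g) {φ : E → ℝ} (hφ : ContDiff ℝ 1 φ)
    (hφs : HasCompactSupport φ) {S : ℝ}
    (hS : S = (eLpNormLESNormFDerivOfEqInnerConst μ 2 : ℝ) ^ 2) :
    ∫ x, ‖g x‖ ^ 6 * φ x ^ 4 ∂μ ≤
      8 * c ^ 4 * S * (8 * d ^ 2 * S) * ((∫ x in tsupport φ, ‖g x‖ ^ 4 ∂μ) *
        ((∫ x, ‖fderiv ℝ (fderiv ℝ g) x‖ ^ 2 * φ x ^ 4 ∂μ) +
          ∫ x, ‖fderiv ℝ g x‖ ^ 2 * φ x ^ 2 * ‖fderiv ℝ φ x‖ ^ 2 ∂μ)) +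
      8 * c ^ 4 * S * (√(∫ x in tsupport φ, ‖g x‖ ^ 4 ∂μ) *
        ∫ x, ‖g x‖ ^ 4 * φ x ^ 2 * ‖fderiv ℝ φ x‖ ^ 2 ∂μ) := by
  have hg' : ContDiff ℝ 1 (fderiv ℝ g) := hg.fderiv_right (by norm_num)
  have hgc := hg.continuous
  have hg'c := hg'.continuous
  have hφc := hφ.continuous
  have hS₈ := sqrt_integral_norm_pow_eight_mul_le μ hE Φ hΦ hc (hg.of_le (by norm_num)) hφ hφs
  have hS₄ := sqrt_integral_norm_pow_four_mul_le μ hE Ψ hΨ hd hg' hφ hφs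
  rw [← hS] at hS₈ hS₄
  have hS₀ : 0 ≤ S := hS ▸ by positivity
  have hsupp (a : E → ℝ) (ha : ∀ x, φ x = 0 → a x = 0) :
      ∫ x in tsupport φ, a x ∂μ = ∫ x, a x ∂μ :=
    setIntegral_eq_integral_of_forall_compl_eq_zero
      fun x hx ↦ ha x (image_eq_zero_of_notMem_tsupport hx)
  have hA₀ : 0 ≤ ∫ x in tsupport φ, ‖g x‖ ^ 4 ∂μ := by positivity
  have hholder (b : E → ℝ) (hb : Continuous b) (hb₀ : ∀ x, 0 ≤ b x)
      (hbφ : ∀ x, φ x = 0 → b x = 0) :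
      ∫ x, ‖g x‖ ^ 2 * b x ∂μ ≤
        √(∫ x in tsupport φ, ‖g x‖ ^ 4 ∂μ) * √(∫ x, b x ^ 2 ∂μ) := by
    have h := setIntegral_mul_le_sqrt_mul_sqrt μ hφs.isCompact (a := fun x ↦ ‖g x‖ ^ 2)
      (by fun_prop) hb (fun x ↦ by positivity) hb₀
    rw [hsupp (fun x ↦ ‖g x‖ ^ 2 * b x) fun x hx ↦ by simp [hbφ x hx],
      hsupp (fun x ↦ b x ^ 2) fun x hx ↦ by simp [hbφ x hx]] at h
    simpa only [← pow_mul] using h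
  have h₆ := hholder (fun x ↦ ‖g x‖ ^ 4 * φ x ^ 4) (by fun_prop)
    (fun x ↦ by positivity) (fun x hx ↦ by simp [hx])
  have h₂ := hholder (fun x ↦ ‖fderiv ℝ g x‖ ^ 2 * φ x ^ 4) (by fun_prop)
    (fun x ↦ by positivity) (fun x hx ↦ by simp [hx])
  simp only [mul_pow, ← pow_mul, ← mul_assoc, ← pow_add, Nat.reduceAdd, Nat.reduceMul] at h₆ h₂
  set A := ∫ x in tsupport φ, ‖g x‖ ^ 4 ∂μ
  set D := (∫ x, ‖fderiv ℝ (fderiv ℝ g) x‖ ^ 2 * φ x ^ 4 ∂μ) +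
    ∫ x, ‖fderiv ℝ g x‖ ^ 2 * φ x ^ 2 * ‖fderiv ℝ φ x‖ ^ 2 ∂μ
  set B := ∫ x, ‖g x‖ ^ 4 * φ x ^ 2 * ‖fderiv ℝ φ x‖ ^ 2 ∂μ
  calc _ ≤ √A * (8 * c ^ 4 * S * (√A * (8 * d ^ 2 * S * D) + B)) := by
        refine h₆.trans (mul_le_mul_of_nonneg_left (hS₈.trans ?_) (Real.sqrt_nonneg _))
        gcongr
        exact h₂.trans (by gcongr)
    _ = 8 * c ^ 4 * S * (8 * d ^ 2 * S) * (√A ^ 2 * D) + 8 * c ^ 4 * S * (√A * B) := by ring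
    _ = _ := by rw [Real.sq_sqrt hA₀]

end SobolevFour

/-- If `V` embeds into a Hilbert space, then so does the space of continuous linear maps from a
Euclidean space to `V`. -/
theorem ContinuousLinearMap.exists_hilbert_embedding {ι V H : Type*} [Fintype ι]
    [NormedAddCommGroup V] [NormedSpace ℝ V] [NormedAddCommGroup H] [InnerProductSpace ℝ H]
    (Φ : V →L[ℝ] H) {c : ℝ} (hΦ : ∀ v, ‖v‖ ≤ ‖Φ v‖) (hc : ‖Φ‖ ≤ c) :
    ∃ Ψ : (EuclideanSpace ℝ ι →L[ℝ] V) →L[ℝ] PiLp 2 (fun _ : ι ↦ H),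
      (∀ T, ‖T‖ ≤ ‖Ψ T‖) ∧ ‖Ψ‖ ≤ √(Fintype.card ι) * c := by
  classical
  have hc₀ : 0 ≤ c := (norm_nonneg Φ).trans hc
  let e (i : ι) : EuclideanSpace ℝ ι := EuclideanSpace.single i 1
  let Ψ : (EuclideanSpace ℝ ι →L[ℝ] V) →L[ℝ] PiLp 2 (fun _ : ι ↦ H) :=
    (PiLp.continuousLinearEquiv 2 ℝ fun _ : ι ↦ H).symm.toContinuousLinearMap ∘L
      ContinuousLinearMap.pi fun i ↦ Φ ∘L ContinuousLinearMap.apply ℝ V (e i)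
  have hΨ (T) (i : ι) : Ψ T i = Φ (T (e i)) := rfl
  refine ⟨Ψ, fun T ↦ T.opNorm_le_bound (norm_nonneg _) fun v ↦ ?_,
    Ψ.opNorm_le_bound (by positivity) fun T ↦ ?_⟩
  · have hv : Φ (T v) = ∑ i, v i • Ψ T i := by
      conv_lhs => rw [← (EuclideanSpace.basisFun ι ℝ).sum_repr v]
      simp [hΨ, e]
    calc ‖T v‖ ≤ ‖∑ i, v i • Ψ T i‖ := hv ▸ hΦ _
      _ ≤ ∑ i, ‖Ψ T i‖ * ‖v i‖ := (norm_sum_le _ _).trans_eq (by simp [norm_smul, mul_comm])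
      _ ≤ ‖Ψ T‖ * ‖v‖ := by
        rw [PiLp.norm_eq_of_L2, EuclideanSpace.norm_eq]
        exact Real.sum_mul_le_sqrt_mul_sqrt _ _ _
  · rw [PiLp.norm_eq_of_L2]
    refine Real.sqrt_le_iff.2 ⟨by positivity, ?_⟩
    have hi (i : ι) : ‖Ψ T i‖ ^ 2 ≤ (c * ‖T‖) ^ 2 := by
      refine pow_le_pow_left₀ (norm_nonneg _) ?_ 2
      rw [hΨ]
      refine (Φ.le_of_opNorm_le hc _).trans ?_
      gcongr
      simpa [e] using T.le_opNorm (e i)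
    calc ∑ i, ‖Ψ T i‖ ^ 2 ≤ ∑ _i : ι, (c * ‖T‖) ^ 2 := Finset.sum_le_sum fun i _ ↦ hi i
      _ = _ := by simp [mul_pow, mul_assoc]

/-- Inequality (df^6) of the Sobolev lemma on `ℝ⁴`: there is a universal `C > 0` such that
for every smooth `f : ℝ⁴ → ℝ^L` and smooth compactly supported `φ`,
`∫ |df|⁶φ⁴ ≤ C (∫_{supp φ} |df|⁴)(∫ |∇²df|²φ⁴ + ∫ |∇df|²φ²|∇φ|²)
  + C (∫_{supp φ} |df|⁴)^{1/2} (∫ |df|⁴φ²|∇φ|²)`. -/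
theorem stmt_11 : ∃ C > (0:ℝ), ∀ (L : ℕ), 1 ≤ L →
    ∀ f : EuclideanSpace ℝ (Fin 4) → EuclideanSpace ℝ (Fin L), ContDiff ℝ (⊤ : ℕ∞) f →
    ∀ φ : EuclideanSpace ℝ (Fin 4) → ℝ, ContDiff ℝ (⊤ : ℕ∞) φ → HasCompactSupport φ →
    ∫ x, ‖fderiv ℝ f x‖ ^ 6 * φ x ^ 4 ≤
      C * (∫ x in tsupport φ, ‖fderiv ℝ f x‖ ^ 4) *
        ((∫ x, ‖iteratedFDeriv ℝ 3 f x‖ ^ 2 * φ x ^ 4) +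
          ∫ x, ‖iteratedFDeriv ℝ 2 f x‖ ^ 2 * φ x ^ 2 * ‖fderiv ℝ φ x‖ ^ 2) +
      C * Real.sqrt (∫ x in tsupport φ, ‖fderiv ℝ f x‖ ^ 4) *
        (∫ x, ‖fderiv ℝ f x‖ ^ 4 * φ x ^ 2 * ‖fderiv ℝ φ x‖ ^ 2) := by
  set S := (eLpNormLESNormFDerivOfEqInnerConst
    (volume : Measure (EuclideanSpace ℝ (Fin 4))) 2 : ℝ) ^ 2
  have hE : Module.finrank ℝ (EuclideanSpace ℝ (Fin 4)) = 4 := by simp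
  refine ⟨8 * 2 ^ 4 * S * (8 * 4 ^ 2 * S) + 8 * 2 ^ 4 * S + 1, by positivity,
    fun L _ f hf φ hφ hφs ↦ ?_⟩
  obtain ⟨Φ₁, hΦ₁, hc₁⟩ := ContinuousLinearMap.exists_hilbert_embedding (ι := Fin 4)
    (.id ℝ (EuclideanSpace ℝ (Fin L))) (fun _ ↦ le_rfl) ContinuousLinearMap.norm_id_le
  obtain ⟨Φ₂, hΦ₂, hc₂⟩ := ContinuousLinearMap.exists_hilbert_embedding (ι := Fin 4) Φ₁ hΦ₁ hc₁
  have h4 : √(4 : ℝ) = 2 := by rw [Real.sqrt_eq_iff_mul_self_eq] <;> norm_num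
  norm_num [h4] at hc₁ hc₂
  have hu : ContDiff ℝ (⊤ : ℕ∞) (fderiv ℝ f) := hf.fderiv_right (by simp)
  simp only [norm_iteratedFDeriv_two, norm_iteratedFDeriv_three]
  refine (integral_norm_pow_six_mul_le volume hE Φ₁ hΦ₁ hc₁ Φ₂ hΦ₂ hc₂
    (contDiff_infty.1 hu 2) (hφ.of_le (by simp)) hφs (S := S) rfl).trans ?_
  rw [mul_assoc (_ + _) (∫ x in tsupport φ, _), mul_assoc (_ + _) √_]
  have hS : 0 ≤ S := by positivity
  have hM : 0 ≤ 8 * 2 ^ 4 * S := by positivity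
  have hMN : 0 ≤ 8 * 2 ^ 4 * S * (8 * 4 ^ 2 * S) := by positivity
  exact add_le_add (mul_le_mul_of_nonneg_right (by linarith) (by positivity))
    (mul_le_mul_of_nonneg_right (by linarith) (by positivity))
end

section
/- Let $a, b > 0$ and let $\phi : [0,\infty) \to [0,\infty)$ be continuous and nonnegative. Suppose $u : [0,\infty) \to \mathbb{R}$ is differentiable, $u(0) = 0$, and $u'(t) = b\, e^{-4u(t)} \phi(t) - a$ for all $t \ge 0$. If $M \ge 0$ is such that $\phi(s) \le M$ for all $s \ge 0$, then for every $t \ge 0$, $e^{-4u(t)} \ge \frac{1}{1 + \frac{b}{a} M}$; in particular $e^{-4u(t)}$ is bounded below by a positive constant depending only on $a$, $b$ and $M$. -/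
/-- The uniform parabolicity estimate: for a solution of `u' = b e^{-4u} φ - a` with
`u(0) = 0`, `a, b > 0`, `0 ≤ φ ≤ M` continuous, one has
`e^{-4u(t)} ≥ 1/(1 + (b/a) M)` for every `t ≥ 0`. -/
theorem stmt_13 (a b : ℝ) (ha : 0 < a) (hb : 0 < b)
    (φ u : ℝ → ℝ) (hφc : ContinuousOn φ (Set.Ici 0)) (hφ0 : ∀ t ≥ (0:ℝ), 0 ≤ φ t)
    (hu0 : u 0 = 0)
    (hu : ∀ t ≥ (0:ℝ),
      HasDerivWithinAt u (b * Real.exp (-4 * u t) * φ t - a) (Set.Ici 0) t)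
    (M : ℝ) (hM : 0 ≤ M) (hφM : ∀ s ≥ (0:ℝ), φ s ≤ M) :
    ∀ t ≥ (0:ℝ), 1 / (1 + b / a * M) ≤ Real.exp (-4 * u t) := by
  have hderiv : ∀ s ≥ (0:ℝ), HasDerivWithinAt
      (fun s => (Real.exp (4 * u s) - b / a * M) * Real.exp (4 * a * s))
      (4 * b * (φ s - M) * Real.exp (4 * a * s)) (Set.Ici 0) s := by
    intro s hs
    have h₁ := (((hu s hs).const_mul 4).exp.sub_const (b / a * M)).mul
      ((((hasDerivAt_id s).const_mul (4 * a)).exp).hasDerivWithinAt (s := Set.Ici 0))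
    refine h₁.congr_deriv ?_
    have hexp : Real.exp (4 * u s) * Real.exp (-4 * u s) = 1 := by
      rw [← Real.exp_add, ← Real.exp_zero]
      ring_nf
    have hba : b / a * a = b := div_mul_cancel₀ b ha.ne'
    simp only [id]
    linear_combination (4 * b * φ s * Real.exp (4 * a * s)) * hexp
      - 4 * M * Real.exp (4 * a * s) * hba
  have hanti : AntitoneOn
      (fun s => (Real.exp (4 * u s) - b / a * M) * Real.exp (4 * a * s)) (Set.Ici 0) := by
    refine antitoneOn_of_hasDerivWithinAt_nonpos (convex_Ici 0)
      (fun s hs => (hderiv s hs).continuousWithinAt)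
      (fun s hs => (hderiv s (interior_subset hs)).mono interior_subset) fun s hs => ?_
    exact mul_nonpos_of_nonpos_of_nonneg
      (mul_nonpos_of_nonneg_of_nonpos (by positivity)
        (sub_nonpos.2 (hφM s (interior_subset hs)))) (Real.exp_pos _).le
  intro t ht
  have hle := hanti (Set.mem_Ici.2 le_rfl) (Set.mem_Ici.2 ht) ht
  simp only [hu0, mul_zero, Real.exp_zero, mul_one] at hle
  have hM' : 0 ≤ b / a * M := by positivity
  have hone : 1 ≤ Real.exp (4 * a * t) := Real.one_le_exp (by positivity)
  have hupper : Real.exp (4 * u t) ≤ 1 + b / a * M := by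
    by_contra! h
    nlinarith
  rw [neg_mul, Real.exp_neg, ← one_div]
  exact one_div_le_one_div_of_le (Real.exp_pos _) hupper
end
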